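/- Every finite family of pairwise non-colliding cuboids rooted at points of ℤ³, in which each cuboid's three side lengths are odd positive integers (possibly different from cuboid to cuboid), admits a proper 8-coloring of its contact graph. -/

import Mathlib

/-- A cuboid with integer root and integer dimensions. -/
structure Cuboid where
  root : ℤ × ℤ × ℤ
  dims : ℤ × ℤ × ℤ
deriving DecidableEq

namespace Cuboid

/-- The dimensions are positive. -/
def valid (C : Cuboid) : Prop :=
  0 < C.dims.1 ∧ 0 < C.dims.2.1 ∧ 0 < C.dims.2.2

/-- The closed cuboid `[x,x+a] × [y,y+b] × [z,z+c] ⊆ ℝ³`. -/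
def toSet (C : Cuboid) : Set (ℝ × ℝ × ℝ) :=
  {p | (C.root.1 : ℝ) ≤ p.1 ∧ p.1 ≤ C.root.1 + C.dims.1 ∧
       (C.root.2.1 : ℝ) ≤ p.2.1 ∧ p.2.1 ≤ C.root.2.1 + C.dims.2.1 ∧
       (C.root.2.2 : ℝ) ≤ p.2.2 ∧ p.2.2 ≤ C.root.2.2 + C.dims.2.2}

/-- The open cuboid `(x,x+a) × (y,y+b) × (z,z+c) ⊆ ℝ³` (the interior). -/
def inte (C : Cuboid) : Set (ℝ × ℝ × ℝ) :=
  {p | (C.root.1 : ℝ) < p.1 ∧ p.1 < C.root.1 + C.dims.1 ∧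
       (C.root.2.1 : ℝ) < p.2.1 ∧ p.2.1 < C.root.2.1 + C.dims.2.1 ∧
       (C.root.2.2 : ℝ) < p.2.2 ∧ p.2.2 < C.root.2.2 + C.dims.2.2}

/-- The set `(ℤ×ℤ×ℝ) ∪ (ℤ×ℝ×ℤ) ∪ (ℝ×ℤ×ℤ)` of grid lines. -/
def grid : Set (ℝ × ℝ × ℝ) :=
  {p | ((∃ m : ℤ, p.1 = m) ∧ (∃ n : ℤ, p.2.1 = n)) ∨
       ((∃ m : ℤ, p.1 = m) ∧ (∃ n : ℤ, p.2.2 = n)) ∨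
       ((∃ m : ℤ, p.2.1 = m) ∧ (∃ n : ℤ, p.2.2 = n))}

/-- Two cuboids collide when their interiors intersect. -/
def Collide (C D : Cuboid) : Prop := (C.inte ∩ D.inte).Nonempty

/-- Two cuboids touch when their interiors are disjoint but their intersection
contains a point outside the grid lines (i.e. it is a non-degenerate rectangle). -/
def Touch (C D : Cuboid) : Prop :=
  ¬ Collide C D ∧ ∃ p ∈ C.toSet ∩ D.toSet, p ∉ grid

end Cuboid

/-- A configuration: a finite family of valid pairwise non-colliding cuboids. -/
def IsConfig (F : Finset Cuboid) : Prop :=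
  (∀ C ∈ F, C.valid) ∧ ∀ C ∈ F, ∀ D ∈ F, C ≠ D → ¬ Cuboid.Collide C D

/-- A type-1 configuration of `[a,b,c]`: every cuboid has dimensions exactly `(a,b,c)`. -/
def Type1 (a b c : ℕ) (F : Finset Cuboid) : Prop :=
  ∀ C ∈ F, C.dims = ((a : ℤ), (b : ℤ), (c : ℤ))

/-- A type-2 configuration of `[a,b,c]`: every cuboid has dimensions `(a,b,c)` or `(b,a,c)`. -/
def Type2 (a b c : ℕ) (F : Finset Cuboid) : Prop :=
  ∀ C ∈ F, C.dims = ((a : ℤ), (b : ℤ), (c : ℤ)) ∨ C.dims = ((b : ℤ), (a : ℤ), (c : ℤ))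

/-- A type-3 configuration of `[a,b,c]`: every cuboid's dimensions are a permutation of `(a,b,c)`. -/
def Type3 (a b c : ℕ) (F : Finset Cuboid) : Prop :=
  ∀ C ∈ F, C.dims = ((a : ℤ), (b : ℤ), (c : ℤ)) ∨ C.dims = ((a : ℤ), (c : ℤ), (b : ℤ)) ∨
    C.dims = ((b : ℤ), (a : ℤ), (c : ℤ)) ∨ C.dims = ((b : ℤ), (c : ℤ), (a : ℤ)) ∨
    C.dims = ((c : ℤ), (a : ℤ), (b : ℤ)) ∨ C.dims = ((c : ℤ), (b : ℤ), (a : ℤ))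

/-- A proper `k`-coloring of a configuration: touching cuboids get distinct colors. -/
def ProperColoring (k : ℕ) (F : Finset Cuboid) : Prop :=
  ∃ κ : Cuboid → Fin k, ∀ C ∈ F, ∀ D ∈ F, Cuboid.Touch C D → κ C ≠ κ D

/-- Two intervals of odd positive integer lengths whose left endpoints have the same parity have
intersecting interiors as soon as they meet. -/
theorem exists_mem_inter_interior_of_odd {x a y b : ℤ} (ha : 0 < a) (hb : 0 < b)
    (hao : Odd a) (hbo : Odd b) (hxy : x % 2 = y % 2) {p : ℝ}
    (h₁ : (x : ℝ) ≤ p) (h₂ : p ≤ x + a) (h₃ : (y : ℝ) ≤ p) (h₄ : p ≤ y + b) :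
    ∃ q : ℝ, ((x : ℝ) < q ∧ q < x + a) ∧ ((y : ℝ) < q ∧ q < y + b) := by
  have hyx : y ≤ x + a := by exact_mod_cast h₃.trans h₂
  have hxy' : x ≤ y + b := by exact_mod_cast h₁.trans h₄
  obtain ⟨k, rfl⟩ := hao
  obtain ⟨l, rfl⟩ := hbo
  have hmax : max x y < min (x + (2 * k + 1)) (y + (2 * l + 1)) := by omega
  rw [max_lt_iff, lt_min_iff, lt_min_iff] at hmax
  have hreal : max (x : ℝ) y <
      min ((x : ℝ) + (2 * k + 1 : ℤ)) ((y : ℝ) + (2 * l + 1 : ℤ)) := by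
    rw [max_lt_iff, lt_min_iff, lt_min_iff]
    exact_mod_cast hmax
  obtain ⟨q, hq₁, hq₂⟩ := exists_between hreal
  rw [max_lt_iff] at hq₁
  rw [lt_min_iff] at hq₂
  exact ⟨q, ⟨hq₁.1, hq₂.1⟩, ⟨hq₁.2, hq₂.2⟩⟩

/-- The color of a cuboid given by the parities of the coordinates of its root. -/
def Cuboid.parityColor (C : Cuboid) : Fin 8 :=
  ⟨(C.root.1 % 2 + 2 * (C.root.2.1 % 2) + 4 * (C.root.2.2 % 2)).toNat, by omega⟩

theorem Cuboid.emod_two_eq_of_parityColor_eq {C D : Cuboid} (h : C.parityColor = D.parityColor) :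
    C.root.1 % 2 = D.root.1 % 2 ∧ C.root.2.1 % 2 = D.root.2.1 % 2 ∧
      C.root.2.2 % 2 = D.root.2.2 % 2 := by
  simp only [Cuboid.parityColor, Fin.mk.injEq] at h
  omega

/-- Every configuration of cuboids all of whose (positive) side lengths are odd admits a
proper 8-coloring. -/
theorem all_odd_sides_8colorable (F : Finset Cuboid) (hF : IsConfig F)
    (hodd : ∀ C ∈ F, Odd C.dims.1 ∧ Odd C.dims.2.1 ∧ Odd C.dims.2.2) :
    ProperColoring 8 F := by
  refine ⟨Cuboid.parityColor, fun C hC D hD ⟨hCD, p, ⟨hpC, hpD⟩, _⟩ hcol => hCD ?_⟩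
  obtain ⟨hx, hy, hz⟩ := Cuboid.emod_two_eq_of_parityColor_eq hcol
  obtain ⟨c₁, c₂, c₃⟩ := hF.1 C hC
  obtain ⟨d₁, d₂, d₃⟩ := hF.1 D hD
  obtain ⟨oc₁, oc₂, oc₃⟩ := hodd C hC
  obtain ⟨od₁, od₂, od₃⟩ := hodd D hD
  obtain ⟨p₁, p₂, p₃, p₄, p₅, p₆⟩ := hpC
  obtain ⟨q₁, q₂, q₃, q₄, q₅, q₆⟩ := hpD
  obtain ⟨u, ⟨u₁, u₂⟩, u₃, u₄⟩ :=
    exists_mem_inter_interior_of_odd c₁ d₁ oc₁ od₁ hx p₁ p₂ q₁ q₂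
  obtain ⟨v, ⟨v₁, v₂⟩, v₃, v₄⟩ :=
    exists_mem_inter_interior_of_odd c₂ d₂ oc₂ od₂ hy p₃ p₄ q₃ q₄
  obtain ⟨w, ⟨w₁, w₂⟩, w₃, w₄⟩ :=
    exists_mem_inter_interior_of_odd c₃ d₃ oc₃ od₃ hz p₅ p₆ q₅ q₆
  exact ⟨(u, v, w), ⟨u₁, u₂, v₁, v₂, w₁, w₂⟩, ⟨u₃, u₄, v₃, v₄, w₃, w₄⟩⟩
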